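/- arXiv:math/0303228 — 3 statements merged into one kernel-verified Lean document; each statement's English description precedes it below -/
import Mathlib

section
/- Let I be a combinatorial chamber and W an essential wall of F(I). Then the relative (intrinsic) interior of the cone F(I) ∩ W is contained in ⋂_{σ∈I(W|cut)} interior(C(σ)) (where the intersection over an empty family is ℝ^r). -/
noncomputable section

/-- The closed convex cone of nonnegative linear combinations of `{φ i : i ∈ σ}`. -/
def coneOf {N r : ℕ} (φ : Fin N → (Fin r → ℝ)) (σ : Finset (Fin N)) : Set (Fin r → ℝ) :=
  {y | ∃ c : Fin N → ℝ, (∀ i, 0 ≤ c i) ∧ (∀ i, i ∉ σ → c i = 0) ∧ y = ∑ i, c i • φ i}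

/-- `σ` is a basic subset: `r` indices whose vectors are linearly independent. -/
def IsBasic {N r : ℕ} (φ : Fin N → (Fin r → ℝ)) (σ : Finset (Fin N)) : Prop :=
  σ.card = r ∧ LinearIndependent ℝ (fun i : {i // i ∈ σ} => φ i)

/-- `F(I) = ⋂_{σ ∈ I} C(σ)`. -/
def Fcone {N r : ℕ} (φ : Fin N → (Fin r → ℝ)) (I : Set (Finset (Fin N))) :
    Set (Fin r → ℝ) :=
  ⋂ σ ∈ I, coneOf φ σ

/-- `I` is feasible when `F(I)` has nonempty interior. -/
def IsFeasible {N r : ℕ} (φ : Fin N → (Fin r → ℝ)) (I : Set (Finset (Fin N))) : Prop :=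
  (interior (Fcone φ I)).Nonempty

/-- A combinatorial chamber: a maximal feasible set of basic subsets. -/
def IsChamber {N r : ℕ} (φ : Fin N → (Fin r → ℝ)) (I : Set (Finset (Fin N))) : Prop :=
  (∀ σ ∈ I, IsBasic φ σ) ∧ IsFeasible φ I ∧
  ∀ J : Set (Finset (Fin N)), I ⊆ J → (∀ σ ∈ J, IsBasic φ σ) → IsFeasible φ J → J = I

/-- A wall: an `(r-1)`-dimensional subspace spanned by `r - 1` linearly independent
vectors from `Δ⁺`. -/
def IsWall {N r : ℕ} (φ : Fin N → (Fin r → ℝ)) (W : Submodule ℝ (Fin r → ℝ)) : Prop :=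
  ∃ s : Finset (Fin N), s.card = r - 1 ∧
    LinearIndependent ℝ (fun i : {i // i ∈ s} => φ i) ∧
    W = Submodule.span ℝ (φ '' (s : Set (Fin N)))

/-- `σ ∈ I(W|facet)` relative to a defining functional `f` for the wall `W`:
`|σ ∩ zeros(W)| = r - 1`. -/
def FacetOf {N r : ℕ} (φ : Fin N → (Fin r → ℝ)) (f : (Fin r → ℝ) →ₗ[ℝ] ℝ)
    (σ : Finset (Fin N)) : Prop :=
  ((σ : Set (Fin N)) ∩ {i | f (φ i) = 0}).ncard = r - 1

/-- `σ ∈ I(W|cut)` relative to a defining functional `f` for the wall `W`: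
`σ` meets both open sides of `W`. -/
def CutOf {N r : ℕ} (φ : Fin N → (Fin r → ℝ)) (f : (Fin r → ℝ) →ₗ[ℝ] ℝ)
    (σ : Finset (Fin N)) : Prop :=
  (∃ i ∈ σ, 0 < f (φ i)) ∧ (∃ i ∈ σ, f (φ i) < 0)

/-- The basis of `ℝ^r` formed by the vectors of a nonempty basic subset. -/
def IsBasic.basis {N r : ℕ} {φ : Fin N → (Fin r → ℝ)} {σ : Finset (Fin N)}
    (h : IsBasic φ σ) (hσ : σ.Nonempty) : Module.Basis {i // i ∈ σ} ℝ (Fin r → ℝ) :=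
  haveI : Nonempty {i // i ∈ σ} := hσ.to_subtype
  basisOfLinearIndependentOfCardEqFinrank h.2 (by simp [h.1])

theorem IsBasic.basis_apply {N r : ℕ} {φ : Fin N → (Fin r → ℝ)} {σ : Finset (Fin N)}
    (h : IsBasic φ σ) (hσ : σ.Nonempty) (i : {i // i ∈ σ}) : h.basis hσ i = φ i := by
  simp [IsBasic.basis]

theorem IsBasic.mem_coneOf_iff {N r : ℕ} {φ : Fin N → (Fin r → ℝ)} {σ : Finset (Fin N)}
    (h : IsBasic φ σ) (hσ : σ.Nonempty) (x : Fin r → ℝ) :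
    x ∈ coneOf φ σ ↔ ∀ i, 0 ≤ (h.basis hσ).coord i x := by
  have hsum (c : Fin N → ℝ) (hc : ∀ i, i ∉ σ → c i = 0) :
      ∑ i, c i • φ i = ∑ i : {i // i ∈ σ}, c i • h.basis hσ i := by
    simp only [h.basis_apply]
    rw [Finset.sum_coe_sort σ (fun i => c i • φ i)]
    refine (Finset.sum_subset (Finset.subset_univ σ) fun i _ hi => ?_).symm
    rw [hc i hi, zero_smul]
  constructor
  · rintro ⟨c, hc, hcσ, rfl⟩ i
    rw [hsum c hcσ, Module.Basis.coord_apply, Module.Basis.repr_sum_self]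
    exact hc i
  · intro hx
    refine ⟨fun i => if hi : i ∈ σ then (h.basis hσ).coord ⟨i, hi⟩ x else 0,
      fun i => ?_, fun i hi => dif_neg hi, ?_⟩
    · dsimp only
      split_ifs
      exacts [hx _, le_rfl]
    · rw [hsum _ fun i hi => dif_neg hi]
      simpa using ((h.basis hσ).sum_repr x).symm

theorem IsBasic.mem_interior_coneOf {N r : ℕ} {φ : Fin N → (Fin r → ℝ)}
    {σ : Finset (Fin N)} (h : IsBasic φ σ) (hσ : σ.Nonempty) {x : Fin r → ℝ}
    (hx : ∀ i, 0 < (h.basis hσ).coord i x) : x ∈ interior (coneOf φ σ) := by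
  refine mem_interior.2 ⟨{y | ∀ i, 0 < (h.basis hσ).coord i y}, fun y hy =>
    (h.mem_coneOf_iff hσ y).2 fun i => (hy i).le, ?_, hx⟩
  simp only [Set.ofPred_forall]
  exact isOpen_iInter_of_finite fun i =>
    isOpen_lt continuous_const (LinearMap.continuous_of_finiteDimensional _)

/-- A linear functional that is nonnegative on a set and vanishes at a point of its intrinsic
interior vanishes on the whole set. -/
theorem eq_zero_of_mem_intrinsicInterior {E : Type*} [AddCommGroup E] [Module ℝ E]
    [TopologicalSpace E] [IsTopologicalAddGroup E] [ContinuousSMul ℝ E] {K : Set E}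
    {g : E →ₗ[ℝ] ℝ} (hg : ∀ x ∈ K, 0 ≤ g x) {y : E} (hy : y ∈ intrinsicInterior ℝ K)
    (hgy : g y = 0) {z : E} (hz : z ∈ K) : g z = 0 := by
  obtain ⟨⟨y, hyA⟩, hyI, rfl⟩ := mem_intrinsicInterior.1 hy
  have hzA := subset_affineSpan ℝ K hz
  let p : ℝ → affineSpan ℝ K := fun t =>
    ⟨AffineMap.lineMap y z t, AffineMap.lineMap_mem t hyA hzA⟩
  have hp : Continuous p := by
    refine Continuous.subtype_mk ?_ _
    change Continuous fun t : ℝ => t • (z - y) + y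
    fun_prop
  have hp0 : p 0 = ⟨y, hyA⟩ := Subtype.ext (AffineMap.lineMap_apply_zero y z)
  have hev : ∀ᶠ t in nhds (0 : ℝ), p t ∈ interior ((↑) ⁻¹' K : Set (affineSpan ℝ K)) :=
    hp.continuousAt.eventually_mem (by rw [hp0]; exact isOpen_interior.mem_nhds hyI)
  obtain ⟨ε, hε, hball⟩ := Metric.eventually_nhds_iff.1 hev
  have hmem := interior_subset (hball (y := -(ε / 2)) (by
    rw [Real.dist_eq, sub_zero, abs_neg, abs_of_pos (by positivity)]; linarith))
  have hle : 0 ≤ g (AffineMap.lineMap y z (-(ε / 2))) := hg _ hmem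
  simp only [AffineMap.lineMap_apply, vsub_eq_sub, vadd_eq_add, map_add, map_smul, map_sub,
    smul_eq_mul] at hle hgy
  rw [hgy] at hle
  have := hg z hz
  nlinarith

theorem finrank_ker_add_one {r : ℕ} {f : (Fin r → ℝ) →ₗ[ℝ] ℝ} (hf : f ≠ 0) :
    Module.finrank ℝ (LinearMap.ker f) + 1 = r := by
  have h := f.finrank_range_add_finrank_ker
  rw [LinearMap.range_eq_top.2 (LinearMap.surjective hf), finrank_top] at h
  simp only [Module.finrank_self, Module.finrank_fin_fun] at h
  omega

/-- the relative interior of `F(I) ∩ W` is contained in the intersection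
of the interiors of the cones `C(σ)` for `σ ∈ I(W|cut)`. -/
theorem relint_subset_cut_interiors
    {N r : ℕ} (φ : Fin N → (Fin r → ℝ)) (hφ : ∀ i, φ i ≠ 0)
    (hspan : Submodule.span ℝ (Set.range φ) = ⊤)
    (I : Set (Finset (Fin N))) (hI : IsChamber φ I)
    (W : Submodule ℝ (Fin r → ℝ)) (hW : IsWall φ W)
    (f : (Fin r → ℝ) →ₗ[ℝ] ℝ) (hker : LinearMap.ker f = W)
    (hside : ∀ x ∈ Fcone φ I, 0 ≤ f x)
    (hdim : Module.finrank ℝ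
      (vectorSpan ℝ (Fcone φ I ∩ (W : Set (Fin r → ℝ)))) = r - 1) :
    intrinsicInterior ℝ (Fcone φ I ∩ (W : Set (Fin r → ℝ))) ⊆
      ⋂ σ ∈ {σ | σ ∈ I ∧ CutOf φ f σ}, interior (coneOf φ σ) := by
  intro y hy
  simp only [Set.mem_iInter]
  rintro σ ⟨hσI, ⟨p, hpσ, hp⟩, ⟨q, hqσ, hq⟩⟩
  have hB := hI.1 σ hσI
  have hne : σ.Nonempty := ⟨p, hpσ⟩
  have hsub : ∀ x ∈ Fcone φ I ∩ (W : Set (Fin r → ℝ)), x ∈ coneOf φ σ := fun x hx =>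
    Set.mem_iInter₂.1 hx.1 σ hσI
  refine hB.mem_interior_coneOf hne fun j => ?_
  set g := (hB.basis hne).coord j with hg
  have hgK : ∀ x ∈ Fcone φ I ∩ (W : Set (Fin r → ℝ)), 0 ≤ g x := fun x hx =>
    (hB.mem_coneOf_iff hne x).1 (hsub x hx) j
  refine (hgK y (intrinsicInterior_subset hy)).lt_of_ne' fun hgy => ?_
  have hvan : ∀ x ∈ Fcone φ I ∩ (W : Set (Fin r → ℝ)), g x = 0 := fun x hx =>
    eq_zero_of_mem_intrinsicInterior hgK hy hgy hx
  have hspan_le (V : Submodule ℝ (Fin r → ℝ))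
      (hV : Fcone φ I ∩ (W : Set (Fin r → ℝ)) ⊆ V) :
      vectorSpan ℝ (Fcone φ I ∩ (W : Set (Fin r → ℝ))) ≤ V := by
    rw [vectorSpan_def, Submodule.span_le]
    rintro _ ⟨a, ha, b, hb, rfl⟩
    exact V.sub_mem (hV ha) (hV hb)
  have hspan_ker : vectorSpan ℝ (Fcone φ I ∩ (W : Set (Fin r → ℝ))) = LinearMap.ker f := by
    refine Submodule.eq_of_le_of_finrank_eq
      (hker ▸ hspan_le W Set.inter_subset_right) ?_
    have := finrank_ker_add_one (f := f) (by rintro rfl; simp at hp)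
    omega
  have hgne : g ≠ 0 := fun h0 => by
    have h1 : g (hB.basis hne j) = 1 := by simp [hg]
    simp [h0] at h1
  have hker_eq : LinearMap.ker f = LinearMap.ker g := by
    refine Submodule.eq_of_le_of_finrank_eq (hspan_ker ▸ hspan_le _ hvan) ?_
    have h1 := finrank_ker_add_one (f := f) (by rintro rfl; simp at hp)
    have h2 := finrank_ker_add_one hgne
    omega
  have hzero (i : Fin N) (hi : i ∈ σ) (hij : i ≠ j) : f (φ i) = 0 := by
    have hgi : φ i ∈ LinearMap.ker g := by
      have hne' : (⟨i, hi⟩ : {i // i ∈ σ}) ≠ j := fun h => hij (congrArg Subtype.val h)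
      rw [LinearMap.mem_ker, ← hB.basis_apply hne ⟨i, hi⟩]
      simp [hg, hne']
    rwa [← hker_eq] at hgi
  by_cases hpj : p = j
  · have hqj : q ≠ j := by rintro rfl; rw [hpj] at hp; exact hp.not_gt hq
    exact hq.ne (hzero q hqσ hqj)
  · exact hp.ne' (hzero p hpσ hpj)

end
end

section
/- Let I be a combinatorial chamber and W an essential wall of F(I). Then I(W|facet) ≠ ∅, i.e. there exists σ ∈ I such that |σ ∩ zeros(W)| = r−1. -/
noncomputable section

open Module

/-- If a nonzero functional `f` is nonnegative on a polyhedral cone, then one of the functionals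
defining the cone vanishes on the face cut out by `f = 0`. -/
lemma exists_functional_eq_zero_on_face {E ι : Type*} [NormedAddCommGroup E] [NormedSpace ℝ E]
    [FiniteDimensional ℝ E] [Finite ι] (L : ι → E →ₗ[ℝ] ℝ) (f : E →ₗ[ℝ] ℝ) (hf : f ≠ 0)
    (hside : ∀ x, (∀ i, 0 ≤ L i x) → 0 ≤ f x) :
    ∃ i, ∀ x, (∀ j, 0 ≤ L j x) → f x = 0 → L i x = 0 := by
  cases nonempty_fintype ι
  by_contra! h
  choose p hp hfp hLp using h
  have hpos : ∀ i, 0 < L i (∑ j, p j) := fun i => by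
    rw [map_sum]
    exact Finset.sum_pos' (fun j _ => hp j i)
      ⟨i, Finset.mem_univ i, lt_of_le_of_ne (hp i i) (hLp i).symm⟩
  have hmin : IsLocalMin f.toContinuousLinearMap (∑ j, p j) := by
    have hnear : ∀ᶠ x in nhds (∑ j, p j), ∀ i, 0 < L i x :=
      Filter.eventually_all.2 fun i =>
        (L i).continuous_of_finiteDimensional.continuousAt.eventually_const_lt (hpos i)
    filter_upwards [hnear] with x hx
    simpa [hfp] using hside x fun i => (hx i).le
  have hderiv := hmin.hasFDerivAt_eq_zero f.toContinuousLinearMap.hasFDerivAt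
  exact hf (LinearMap.toContinuousLinearMap.map_eq_zero_iff.1 hderiv)

/-- For a basic subset `σ` the vectors `φ i`, `i ∈ σ`, form a basis. -/
lemma IsBasic.exists_basis {N r : ℕ} {φ : Fin N → (Fin r → ℝ)} {σ : Finset (Fin N)}
    (h : IsBasic φ σ) : ∃ b : Basis {i // i ∈ σ} ℝ (Fin r → ℝ), ∀ i, b i = φ i := by
  have hspan : ⊤ ≤ Submodule.span ℝ (Set.range fun i : {i // i ∈ σ} => φ i) :=
    (h.2.span_eq_top_of_card_eq_finrank' (by simp [h.1])).ge
  exact ⟨Basis.mk h.2 hspan, fun i => Basis.mk_apply h.2 hspan i⟩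

/-- A simplicial cone is cut out by the coordinate functionals of its generators. -/
lemma mem_coneOf_iff_coord_nonneg {N r : ℕ} {φ : Fin N → (Fin r → ℝ)} {σ : Finset (Fin N)}
    (b : Basis {i // i ∈ σ} ℝ (Fin r → ℝ)) (hb : ∀ i, b i = φ i) (y : Fin r → ℝ) :
    y ∈ coneOf φ σ ↔ ∀ i, 0 ≤ b.coord i y := by
  constructor
  · rintro ⟨c, hc, hcσ, rfl⟩ i
    have hsum : ∑ j, c j • φ j = ∑ j : {j // j ∈ σ}, c j • b j := by
      rw [← Finset.sum_subset (Finset.subset_univ σ) fun j _ hj => by simp [hcσ j hj],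
        ← Finset.sum_coe_sort σ]
      simp [hb]
    rw [hsum, Basis.coord_apply, b.repr_sum_self]
    exact hc i
  · intro h
    refine ⟨fun i => if hi : i ∈ σ then b.coord ⟨i, hi⟩ y else 0, fun i => ?_, fun i hi => ?_, ?_⟩
    · dsimp only
      split_ifs with hi
      exacts [h _, le_rfl]
    · simp [hi]
    · rw [← Finset.sum_subset (Finset.subset_univ σ) fun j _ hj => by simp [hj],
        ← Finset.sum_coe_sort σ]
      conv_lhs => rw [← b.sum_repr y]
      simp [hb]

/-- If `f` has the same kernel as a coordinate functional of the basis formed by `σ`, then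
`σ` has a facet on `ker f`. -/
lemma facetOf_of_ker_eq_ker_coord {N r : ℕ} {φ : Fin N → (Fin r → ℝ)} {σ : Finset (Fin N)}
    (hcard : σ.card = r) (b : Basis {i // i ∈ σ} ℝ (Fin r → ℝ)) (hb : ∀ i, b i = φ i)
    (f : (Fin r → ℝ) →ₗ[ℝ] ℝ) (i : {i // i ∈ σ})
    (hker : LinearMap.ker f = LinearMap.ker (b.coord i)) : FacetOf φ f σ := by
  have hmem : ∀ j : {j // j ∈ σ}, f (φ j) = 0 ↔ j ≠ i := fun j => by
    rw [← LinearMap.mem_ker, hker, LinearMap.mem_ker, ← hb, Basis.coord_apply, b.repr_self,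
      Finsupp.single_apply]
    simp
  have hset : (σ : Set (Fin N)) ∩ {j | f (φ j) = 0} = (σ.erase i : Finset (Fin N)) := by
    ext j
    simp only [Set.mem_inter_iff, Finset.mem_coe, Set.mem_ofPred_eq, Finset.mem_erase]
    constructor
    · rintro ⟨hj, hfj⟩
      exact ⟨fun h => (hmem ⟨j, hj⟩).1 hfj (Subtype.ext h), hj⟩
    · rintro ⟨hji, hj⟩
      exact ⟨hj, (hmem ⟨j, hj⟩).2 fun h => hji (congrArg Subtype.val h)⟩
  rw [FacetOf, hset, Set.ncard_coe_finset, Finset.card_erase_of_mem i.2, hcard]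

/-- The kernel of a nonzero functional on `ℝ^r` has dimension `r - 1`. -/
lemma finrank_ker_of_ne_zero {r : ℕ} {g : (Fin r → ℝ) →ₗ[ℝ] ℝ} (hg : g ≠ 0) :
    finrank ℝ (LinearMap.ker g) = r - 1 := by
  have h := Module.Dual.finrank_ker_add_one_of_ne_zero (f := g) hg
  rw [finrank_fin_fun] at h
  omega

/-- In dimension zero the empty set belongs to every combinatorial chamber. -/
lemma IsChamber.empty_mem {N : ℕ} {φ : Fin N → (Fin 0 → ℝ)} {I : Set (Finset (Fin N))}
    (hI : IsChamber φ I) (hφ : ∀ i, φ i ≠ 0) : ∅ ∈ I := by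
  have hN : IsEmpty (Fin N) := ⟨fun i => hφ i (Subsingleton.elim _ _)⟩
  have hbasic : ∀ σ : Finset (Fin N), IsBasic φ σ := fun σ => by
    rw [Subsingleton.elim σ ∅]
    exact ⟨rfl, linearIndependent_empty_type⟩
  have hF : Fcone φ Set.univ = Set.univ := by
    refine Set.eq_univ_of_forall fun x => Set.mem_iInter₂.2 fun σ _ => ?_
    exact ⟨0, fun _ => le_rfl, fun _ _ => rfl, Subsingleton.elim _ _⟩
  have hfeas : IsFeasible φ Set.univ := by rw [IsFeasible, hF, interior_univ]; exact Set.univ_nonempty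
  rw [← hI.2.2 Set.univ (Set.subset_univ I) (fun σ _ => hbasic σ) hfeas]
  trivial

/-- an essential wall of `F(I)` supports a facet of some simplicial cone of
the chamber: `I(W|facet) ≠ ∅`. -/
theorem essential_wall_facet_nonempty
    {N r : ℕ} (φ : Fin N → (Fin r → ℝ)) (hφ : ∀ i, φ i ≠ 0)
    (hspan : Submodule.span ℝ (Set.range φ) = ⊤)
    (I : Set (Finset (Fin N))) (hI : IsChamber φ I)
    (W : Submodule ℝ (Fin r → ℝ)) (hW : IsWall φ W)
    (f : (Fin r → ℝ) →ₗ[ℝ] ℝ) (hker : LinearMap.ker f = W)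
    (hside : ∀ x ∈ Fcone φ I, 0 ≤ f x)
    (hdim : Module.finrank ℝ
      (vectorSpan ℝ (Fcone φ I ∩ (W : Set (Fin r → ℝ)))) = r - 1) :
    ∃ σ ∈ I, FacetOf φ f σ := by
  obtain rfl | hr := Nat.eq_zero_or_pos r
  · exact ⟨∅, hI.empty_mem hφ, by simp [FacetOf]⟩
  have hf : f ≠ 0 := by
    rintro rfl
    obtain ⟨s, hs, hli, hWs⟩ := hW
    have hrank : finrank ℝ W = r - 1 := by
      rw [hWs, Set.image_eq_range]
      exact (finrank_span_eq_card hli).trans (by simp [hs])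
    rw [← hker, LinearMap.ker_zero, finrank_top, finrank_fin_fun] at hrank
    omega
  choose b hb using fun σ : I => (hI.1 σ σ.2).exists_basis
  let L : (Σ σ : I, {i // i ∈ σ.1}) → (Fin r → ℝ) →ₗ[ℝ] ℝ := fun p => (b p.1).coord p.2
  have hF : ∀ x, x ∈ Fcone φ I ↔ ∀ p, 0 ≤ L p x := fun x => by
    simp only [Fcone, Set.mem_iInter, Sigma.forall, Subtype.forall (p := (· ∈ I)), L]
    exact forall₂_congr fun σ hσ => mem_coneOf_iff_coord_nonneg (b ⟨σ, hσ⟩) (hb ⟨σ, hσ⟩) x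
  obtain ⟨⟨σ, i⟩, hi⟩ := exists_functional_eq_zero_on_face L f hf fun x hx =>
    hside x ((hF x).2 hx)
  have hspanW : vectorSpan ℝ (Fcone φ I ∩ (W : Set (Fin r → ℝ))) = W := by
    refine Submodule.eq_of_le_of_finrank_eq ?_ ?_
    · refine Submodule.span_le.2 ?_
      rintro _ ⟨x, hx, y, hy, rfl⟩
      exact W.sub_mem hx.2 hy.2
    · rw [hdim, ← hker, finrank_ker_of_ne_zero hf]
  have hspanL : vectorSpan ℝ (Fcone φ I ∩ (W : Set (Fin r → ℝ))) ≤
      LinearMap.ker ((b σ).coord i) := by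
    have hzero : ∀ x ∈ Fcone φ I ∩ (W : Set (Fin r → ℝ)), (b σ).coord i x = 0 := fun x hx =>
      hi x ((hF x).1 hx.1) (LinearMap.mem_ker.1 (hker ▸ hx.2))
    refine Submodule.span_le.2 ?_
    rintro _ ⟨x, hx, y, hy, rfl⟩
    exact Submodule.sub_mem _ (hzero x hx) (hzero y hy)
  have hcoord : (b σ).coord i ≠ 0 := fun h => by
    simpa using LinearMap.congr_fun h (b σ i)
  refine ⟨σ, σ.2, facetOf_of_ker_eq_ker_coord (hI.1 σ σ.2).1 (b σ) (hb σ) f i ?_⟩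
  refine Submodule.eq_of_le_of_finrank_eq (hker.trans hspanW.symm ▸ hspanL) ?_
  rw [finrank_ker_of_ne_zero hf, finrank_ker_of_ne_zero hcoord]

end
end

section
/- Let I be a combinatorial chamber and W a wall. Fix a labeling H⁺, H⁻ of the two open half-spaces bounded by W, set pos(W) = {i : φ_i ∈ H⁺} and neg(W) = {i : φ_i ∈ H⁻}, and for ν ⊆ {1,…,N} consisting of r−1 indices with {φ_i : i ∈ ν} linearly independent and spanning W, set δ⁺(ν) = {ν ∪ {i} : i ∈ pos(W)} and δ⁻(ν) = {ν ∪ {i} : i ∈ neg(W)}. Assume that W satisfies: (1) I = I(W|facet) ∪ I(W|cut); (2) I(W|facet) ≠ ∅; (3) for every such ν, if δ⁺(ν) ∩ I ≠ ∅ then δ⁺(ν) ⊆ I and δ⁻(ν) ∩ I = ∅, and if δ⁻(ν) ∩ I ≠ ∅ then δ⁻(ν) ⊆ I and δ⁺(ν) ∩ I = ∅; and assume condition (4) fails, i.e. I(W|cut) ≠ ∅ and (⋂_{σ∈I(W|cut)} interior(C(σ))) ∩ W = ∅. Define reflexion(I,W) = I(W|cut) ∪ ⋃{δ⁻(ν)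 : ν as above with ∅ ≠ δ⁺(ν) ⊆ I} ∪ ⋃{δ⁺(ν) : ν as above with ∅ ≠ δ⁻(ν) ⊆ I}. Then reflexion(I,W) is not feasible: F(reflexion(I,W)) has empty interior. -/
noncomputable section

/-- `ν` spans the wall `W`: `r - 1` indices with linearly independent vectors whose
span is `W`. -/
def SpansWall {N r : ℕ} (φ : Fin N → (Fin r → ℝ)) (W : Submodule ℝ (Fin r → ℝ))
    (ν : Finset (Fin N)) : Prop :=
  ν.card = r - 1 ∧ LinearIndependent ℝ (fun i : {i // i ∈ ν} => φ i) ∧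
  Submodule.span ℝ (φ '' (ν : Set (Fin N))) = W

theorem convex_coneOf {N r : ℕ} (φ : Fin N → (Fin r → ℝ)) (σ : Finset (Fin N)) :
    Convex ℝ (coneOf φ σ) := by
  rintro x ⟨c, hc, hcσ, rfl⟩ y ⟨d, hd, hdσ, rfl⟩ a b ha hb -
  refine ⟨fun i => a * c i + b * d i, fun i => ?_, fun i hi => ?_, ?_⟩
  · have := hc i
    have := hd i
    positivity
  · simp [hcσ i hi, hdσ i hi]
  · simp only [Finset.smul_sum, smul_smul, add_smul, Finset.sum_add_distrib]

/-- A functional vanishing on `ν` takes, on the cone of `insert i ν`, only nonnegative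
multiples of its value at `φ i`. -/
theorem exists_apply_eq_mul_of_mem_coneOf_insert {N r : ℕ} {φ : Fin N → (Fin r → ℝ)}
    {f : (Fin r → ℝ) →ₗ[ℝ] ℝ} {ν : Finset (Fin N)} {i : Fin N}
    (hν : ∀ j ∈ ν, f (φ j) = 0) {y : Fin r → ℝ} (hy : y ∈ coneOf φ (insert i ν)) :
    ∃ a : ℝ, 0 ≤ a ∧ f y = a * f (φ i) := by
  obtain ⟨c, hc, hc0, rfl⟩ := hy
  refine ⟨c i, hc i, ?_⟩
  rw [map_sum, Finset.sum_eq_single i]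
  · simp
  · intro j _ hji
    by_cases hj : j ∈ ν
    · simp [hν j hj]
    · simp [hc0 j (by simp [hji, hj])]
  · simp

theorem IsWall.finrank_eq {N r : ℕ} {φ : Fin N → (Fin r → ℝ)}
    {W : Submodule ℝ (Fin r → ℝ)} (hW : IsWall φ W) : Module.finrank ℝ W = r - 1 := by
  obtain ⟨s, hs, hli, rfl⟩ := hW
  have h := finrank_span_eq_card hli
  have hrange : Set.range (fun i : {i // i ∈ s} => φ i) = φ '' (s : Set (Fin N)) := by
    ext; simp
  rw [hrange, Fintype.card_coe, hs] at h
  exact h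

theorem SpansWall.apply_eq_zero {N r : ℕ} {φ : Fin N → (Fin r → ℝ)}
    {W : Submodule ℝ (Fin r → ℝ)} {ν : Finset (Fin N)} (hν : SpansWall φ W ν)
    {f : (Fin r → ℝ) →ₗ[ℝ] ℝ} (hker : LinearMap.ker f = W) {j : Fin N} (hj : j ∈ ν) :
    f (φ j) = 0 := by
  rw [← LinearMap.mem_ker, hker, ← hν.2.2]
  exact Submodule.subset_span ⟨j, hj, rfl⟩

/-- A basic subset with a facet on the wall `W` is obtained from a basis of `W` by adding
one index off the wall. -/
theorem exists_spansWall_of_facetOf {N r : ℕ} {φ : Fin N → (Fin r → ℝ)}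
    {W : Submodule ℝ (Fin r → ℝ)} (hW : IsWall φ W) {f : (Fin r → ℝ) →ₗ[ℝ] ℝ}
    (hker : LinearMap.ker f = W) (hr : 0 < r) {σ : Finset (Fin N)} (hσ : IsBasic φ σ)
    (hfacet : FacetOf φ f σ) :
    ∃ ν i, SpansWall φ W ν ∧ f (φ i) ≠ 0 ∧ insert i ν = σ := by
  classical
  set ν := σ.filter (fun i => f (φ i) = 0) with hνdef
  have hνσ : ν ⊆ σ := Finset.filter_subset _ _
  have hcard : ν.card = r - 1 := by
    have h : ((σ : Set (Fin N)) ∩ {i | f (φ i) = 0}) = (ν : Set (Fin N)) := by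
      ext; simp [hνdef]
    have h' := hfacet
    rw [FacetOf, h, Set.ncard_coe_finset] at h'
    exact h'
  have hli : LinearIndependent ℝ (fun i : {i // i ∈ ν} => φ i) :=
    hσ.2.comp (fun i : {i // i ∈ ν} => (⟨i, hνσ i.2⟩ : {i // i ∈ σ}))
      (fun a b h => Subtype.ext (congrArg (fun x : {i // i ∈ σ} => (x : Fin N)) h))
  have hspan : Submodule.span ℝ (φ '' (ν : Set (Fin N))) = W := by
    refine Submodule.eq_of_le_of_finrank_eq ?_ ?_
    · rw [Submodule.span_le, ← hker]
      rintro _ ⟨j, hj, rfl⟩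
      exact (Finset.mem_filter.1 hj).2
    · rw [hW.finrank_eq, IsWall.finrank_eq ⟨ν, hcard, hli, rfl⟩]
  have hdiff : (σ \ ν).card = 1 := by
    rw [Finset.card_sdiff_of_subset hνσ, hcard, hσ.1]
    omega
  obtain ⟨i, hi⟩ := Finset.card_eq_one.1 hdiff
  have himem : i ∈ σ \ ν := by simp [hi]
  rw [Finset.mem_sdiff] at himem
  refine ⟨ν, i, ⟨hcard, hli, hspan⟩, fun h => himem.2 (Finset.mem_filter.2 ⟨himem.1, h⟩), ?_⟩
  rw [Finset.insert_eq, ← hi, Finset.sdiff_union_of_subset hνσ]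

/-- A convex set meeting both closed sides of a hyperplane meets the hyperplane. -/
theorem Convex.exists_apply_eq_zero {E : Type*} [AddCommGroup E] [Module ℝ E]
    {S : Set E} (hS : Convex ℝ S) (f : E →ₗ[ℝ] ℝ) {x y : E} (hx : x ∈ S) (hy : y ∈ S)
    (hfx : 0 ≤ f x) (hfy : f y ≤ 0) : ∃ z ∈ S, f z = 0 := by
  have h : Set.OrdConnected (f '' S) := (hS.linear_image f).ordConnected
  exact h.out ⟨y, hy, rfl⟩ ⟨x, hx, rfl⟩ ⟨hfy, hfx⟩

/-- performing the reflexion across a wall satisfying conditions (1), (2),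
(3) of Proposition `essential walls` but failing condition (4) yields a non-feasible
collection: the intersection of its cones has empty interior. Sides of `W` are labeled
by a fixed functional `f` with `ker f = W`. -/
theorem reflexion_not_feasible_of_not_condition4
    {N r : ℕ} (φ : Fin N → (Fin r → ℝ)) (hφ : ∀ i, φ i ≠ 0)
    (hspan : Submodule.span ℝ (Set.range φ) = ⊤)
    (I : Set (Finset (Fin N))) (hI : IsChamber φ I)
    (W : Submodule ℝ (Fin r → ℝ)) (hW : IsWall φ W)
    (f : (Fin r → ℝ) →ₗ[ℝ] ℝ) (hker : LinearMap.ker f = W)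
    (h1 : I = {σ | σ ∈ I ∧ FacetOf φ f σ} ∪ {σ | σ ∈ I ∧ CutOf φ f σ})
    (h2 : ∃ σ ∈ I, FacetOf φ f σ)
    (h3 : ∀ ν : Finset (Fin N), SpansWall φ W ν →
      ((∃ i, 0 < f (φ i) ∧ insert i ν ∈ I) →
        (∀ i, 0 < f (φ i) → insert i ν ∈ I) ∧ (∀ i, f (φ i) < 0 → insert i ν ∉ I)) ∧
      ((∃ i, f (φ i) < 0 ∧ insert i ν ∈ I) →
        (∀ i, f (φ i) < 0 → insert i ν ∈ I) ∧ (∀ i, 0 < f (φ i) → insert i ν ∉ I)))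
    (h4cut : {σ | σ ∈ I ∧ CutOf φ f σ}.Nonempty)
    (h4fail : (⋂ σ ∈ {σ | σ ∈ I ∧ CutOf φ f σ}, interior (coneOf φ σ)) ∩
        (W : Set (Fin r → ℝ)) = ∅) :
    interior (Fcone φ
      ({σ | σ ∈ I ∧ CutOf φ f σ} ∪
        {τ | ∃ ν : Finset (Fin N), SpansWall φ W ν ∧
          (∃ i, 0 < f (φ i)) ∧ (∀ i, 0 < f (φ i) → insert i ν ∈ I) ∧
          ∃ i, f (φ i) < 0 ∧ τ = insert i ν} ∪
        {τ | ∃ ν : Finset (Fin N), SpansWall φ W ν ∧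
          (∃ i, f (φ i) < 0) ∧ (∀ i, f (φ i) < 0 → insert i ν ∈ I) ∧
          ∃ i, 0 < f (φ i) ∧ τ = insert i ν})) = ∅ := by
  rw [Set.eq_empty_iff_forall_notMem]
  intro y hy
  obtain ⟨x, hx⟩ := hI.2.1
  obtain ⟨_, -, ⟨p, -, hp⟩, q, -, hq⟩ := h4cut
  have hr : 0 < r := by
    rcases Nat.eq_zero_or_pos r with rfl | h
    · exact absurd (Subsingleton.elim _ _) (hφ p)
    · exact h
  obtain ⟨σ, hσI, hσ⟩ := h2
  obtain ⟨ν, i, hν, hi, rfl⟩ := exists_spansWall_of_facetOf hW hker hr (hI.1 σ hσI) hσ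
  set S := ⋂ σ ∈ {σ | σ ∈ I ∧ CutOf φ f σ}, interior (coneOf φ σ) with hS
  have hSconv : Convex ℝ S := convex_iInter₂ fun τ _ => (convex_coneOf φ τ).interior
  have hxS : x ∈ S := Set.mem_iInter₂.2 fun τ hτ =>
    interior_mono (Set.biInter_subset_of_mem hτ.1) hx
  have hyS : y ∈ S := Set.mem_iInter₂.2 fun τ hτ =>
    interior_mono (fun _ hw => Set.mem_iInter₂.1 hw τ (Or.inl (Or.inl hτ))) hy
  have hν0 : ∀ j ∈ ν, f (φ j) = 0 := fun j hj => hν.apply_eq_zero hker hj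
  obtain ⟨a, ha, hfx⟩ := exists_apply_eq_mul_of_mem_coneOf_insert hν0
    (Set.mem_iInter₂.1 (interior_subset hx) _ hσI)
  have hcross : ∃ z ∈ S, f z = 0 := by
    rcases lt_or_gt_of_ne hi with hneg | hpos
    · have hall := (((h3 ν hν).2 ⟨i, hneg, hσI⟩).1)
      obtain ⟨b, hb, hfy⟩ := exists_apply_eq_mul_of_mem_coneOf_insert hν0
        (Set.mem_iInter₂.1 (interior_subset hy) (insert p ν)
          (Or.inr ⟨ν, hν, ⟨q, hq⟩, hall, p, hp, rfl⟩))
      exact hSconv.exists_apply_eq_zero f hyS hxS (hfy ▸ mul_nonneg hb hp.le)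
        (hfx ▸ mul_nonpos_of_nonneg_of_nonpos ha hneg.le)
    · have hall := (((h3 ν hν).1 ⟨i, hpos, hσI⟩).1)
      obtain ⟨b, hb, hfy⟩ := exists_apply_eq_mul_of_mem_coneOf_insert hν0
        (Set.mem_iInter₂.1 (interior_subset hy) (insert q ν)
          (Or.inl (Or.inr ⟨ν, hν, ⟨p, hp⟩, hall, q, hq, rfl⟩)))
      exact hSconv.exists_apply_eq_zero f hxS hyS (hfx ▸ mul_nonneg ha hpos.le)
        (hfy ▸ mul_nonpos_of_nonneg_of_nonpos hb hq.le)
  obtain ⟨z, hzS, hz⟩ := hcross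
  have hzW : z ∈ W := hker ▸ LinearMap.mem_ker.2 hz
  exact Set.eq_empty_iff_forall_notMem.1 h4fail z ⟨hzS, hzW⟩

end
end
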